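/- (Markov stabilization move M2) Let w be a braid word on n strands and ε ∈ {+1, −1}, and let w' = w ++ [(n, ε)] be the Markov stabilization of w, regarded as a braid word on n+1 strands (appending the generator σ_n^ε). Then there exist an integer b and a unimodular integer matrix P (det P = ±1) such that M(w') = Pᵀ · (M(w) ⊕ [[b, 1], [1, 0]]) · P, where M(w) ⊕ [[b, 1], [1, 0]] denotes the block-diagonal matrix with blocks M(w) and the 2×2 matrix with rows (b, 1) and (1, 0). In particular, the linking matrix of a Markov stabilization is obtained from M(w) by a tube addition (addition of the band X_{m+1} and the circle C_{n+1}) up to unimodular congruence. -/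

import Mathlib

open Matrix

/-- A letter of a braid word: a pair (column, sign). -/
abbrev Letter : Type := ℕ × ℤ

/-- A cycle on the laundry surface: `Sum.inl i` is the circle cycle `C_i` (1-indexed),
`Sum.inr k` is the band cycle `X_{k+1}` (i.e. the band of the letter in position `k`,
0-indexed). -/
abbrev Cyc : Type := ℕ ⊕ ℕ

/-- `w` is a braid word on `n` strands: `n ≥ 2`, `w` nonempty, and each letter `(c, ε)`
has column `1 ≤ c ≤ n - 1` and sign `ε = ±1`. -/
def IsBraidWord (n : ℕ) (w : List Letter) : Prop :=
  2 ≤ n ∧ w ≠ [] ∧ ∀ ℓ ∈ w, 1 ≤ ℓ.1 ∧ ℓ.1 ≤ n - 1 ∧ (ℓ.2 = 1 ∨ ℓ.2 = -1)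

/-- A single B0 move: swap two adjacent letters whose columns differ by more than 1. -/
inductive B0Step : List Letter → List Letter → Prop
  | swap (u v : List Letter) (a b : Letter)
      (h : 1 < (a.1 : ℤ) - (b.1 : ℤ) ∨ 1 < (b.1 : ℤ) - (a.1 : ℤ)) :
      B0Step (u ++ a :: b :: v) (u ++ b :: a :: v)

/-- B0-equivalence: a finite sequence of B0 moves. -/
def B0Equiv : List Letter → List Letter → Prop := Relation.ReflTransGen B0Step

/-- The column of the `k`-th letter (0-indexed) of `w`. -/
def colOf (w : List Letter) (k : ℕ) : ℕ := (w.getD k (0, 0)).1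

/-- The sign of the `k`-th letter (0-indexed) of `w`. -/
def signOf (w : List Letter) (k : ℕ) : ℤ := (w.getD k (0, 0)).2

/-- The band cycles `X_k` with column `c_k ∈ {e - 1, e}`, in decreasing order of `k`. -/
def bandBlock (w : List Letter) (e : ℕ) : List Cyc :=
  ((List.range w.length).reverse.filter fun k => colOf w k == e - 1 || colOf w k == e).map
    Sum.inr

/-- The cycles of `w` in laundry order: for each even `e = 2, 4, …, ≤ n` in increasing
order, the circle `C_e` followed by all bands `X_k` with `c_k ∈ {e-1, e}` in decreasing
order of `k`; then the circles `C_i` for odd `i ≤ n` in decreasing order of `i`. -/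
def laundryList (n : ℕ) (w : List Letter) : List Cyc :=
  (((List.range (n + 1)).filter fun e => e % 2 == 0 && e != 0).flatMap
      fun e => Sum.inl e :: bandBlock w e) ++
    ((List.range (n + 1)).filter fun i => i % 2 == 1).reverse.map Sum.inl

/-- The linking number of (the double push-off of) one cycle of `w` with another. -/
def entry (w : List Letter) : Cyc → Cyc → ℤ
  | Sum.inl _, Sum.inl _ => 0
  | Sum.inr k, Sum.inr l =>
      if k = l then signOf w k
      else if (colOf w l = colOf w k + 1 ∧ k < l) ∨ (colOf w l + 1 = colOf w k ∧ l < k) then 1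
      else 0
  | Sum.inr k, Sum.inl j =>
      if j = colOf w k then -1 else if j = colOf w k + 1 then 1 else 0
  | Sum.inl j, Sum.inr k =>
      if j = colOf w k then -1 else if j = colOf w k + 1 then 1 else 0

/-- The linking matrix `M(w)` of a braid word `w` with `m` letters on `n` strands:
the `(n+m) × (n+m)` integer matrix of linking numbers, rows and columns indexed by the
cycles of `w` in laundry order. -/
def linkMat (n m : ℕ) (w : List Letter) : Matrix (Fin (n + m)) (Fin (n + m)) ℤ :=
  fun p q =>
    entry w ((laundryList n w).getD p (Sum.inl 0)) ((laundryList n w).getD q (Sum.inl 0))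

/-- The block-diagonal matrix `A ⊕ [[b, 1], [1, 0]]`, reindexed by `Fin (s + 2)`. -/
def tubeAdd {s : ℕ} (A : Matrix (Fin s) (Fin s) ℤ) (b : ℤ) :
    Matrix (Fin (s + 2)) (Fin (s + 2)) ℤ :=
  Matrix.reindex finSumFinEquiv finSumFinEquiv
    (Matrix.fromBlocks A 0 0 !![b, 1; 1, 0])

/-- The cycles of a braid word, circles first. -/
def cycleList (n m : ℕ) : List Cyc :=
  (List.range n).map (fun i => Sum.inl (i + 1)) ++ (List.range m).map Sum.inr

theorem nodup_cycleList (n m : ℕ) : (cycleList n m).Nodup := by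
  refine List.Nodup.append ?_ ?_ ?_
  · exact List.nodup_range.map fun a b h => by simpa using h
  · exact List.nodup_range.map Sum.inr_injective
  · intro x hx hy
    simp only [List.mem_map] at hx hy
    obtain ⟨_, _, rfl⟩ := hx
    obtain ⟨_, _, h⟩ := hy
    simp at h

theorem mem_bandBlock_inr {w : List Letter} {e k : ℕ} :
    Sum.inr k ∈ bandBlock w e ↔ k < w.length ∧ (colOf w k = e - 1 ∨ colOf w k = e) := by
  simp [bandBlock]

theorem not_mem_bandBlock_inl {w : List Letter} {e i : ℕ} : Sum.inl i ∉ bandBlock w e := by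
  simp [bandBlock]

theorem nodup_bandBlock (w : List Letter) (e : ℕ) : (bandBlock w e).Nodup :=
  ((List.nodup_reverse.mpr List.nodup_range).filter _).map Sum.inr_injective

theorem nodup_laundryList (n : ℕ) (w : List Letter) : (laundryList n w).Nodup := by
  refine List.Nodup.append ?_ ?_ ?_
  · rw [List.nodup_flatMap]
    refine ⟨fun e _ => List.nodup_cons.mpr ⟨not_mem_bandBlock_inl, nodup_bandBlock w e⟩, ?_⟩
    refine List.Pairwise.imp_of_mem ?_ (List.nodup_range.filter _)
    intro a b ha hb hab x hx hy
    simp only [List.mem_filter, Bool.and_eq_true, beq_iff_eq, bne_iff_ne] at ha hb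
    rcases x with i | k
    · simp only [List.mem_cons, not_mem_bandBlock_inl, or_false, Sum.inl.injEq] at hx hy
      omega
    · simp only [List.mem_cons, reduceCtorEq, false_or, mem_bandBlock_inr] at hx hy
      omega
  · exact (List.nodup_reverse.mpr (List.nodup_range.filter _)).map Sum.inl_injective
  · intro x hx hy
    simp only [List.mem_map, List.mem_reverse, List.mem_filter, beq_iff_eq] at hy
    obtain ⟨i, ⟨_, hi⟩, rfl⟩ := hy
    simp only [List.mem_flatMap, List.mem_filter, Bool.and_eq_true, beq_iff_eq, bne_iff_ne,
      List.mem_cons, not_mem_bandBlock_inl, or_false, Sum.inl.injEq] at hx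
    obtain ⟨e, ⟨_, he, _⟩, rfl⟩ := hx
    omega

theorem IsBraidWord.colOf_bounds {n : ℕ} {w : List Letter} (hw : IsBraidWord n w) {k : ℕ}
    (hk : k < w.length) : 1 ≤ colOf w k ∧ colOf w k + 1 ≤ n := by
  obtain ⟨hn, -, h⟩ := hw
  have := h _ (List.getElem_mem hk)
  rw [colOf, List.getD_eq_getElem _ _ hk]
  omega

theorem IsBraidWord.laundryList_perm {n : ℕ} {w : List Letter} (hw : IsBraidWord n w) :
    (laundryList n w).Perm (cycleList n w.length) := by
  rw [List.perm_ext_iff_of_nodup (nodup_laundryList n w) (nodup_cycleList n _)]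
  rintro (i | k)
  · simp only [laundryList, cycleList, List.mem_append, List.mem_flatMap, List.mem_filter,
      List.mem_range, Bool.and_eq_true, beq_iff_eq, bne_iff_ne, List.mem_cons,
      not_mem_bandBlock_inl, or_false, List.mem_map, List.mem_reverse, Sum.inl.injEq,
      reduceCtorEq, and_false, exists_false]
    constructor
    · rintro (⟨e, h, rfl⟩ | ⟨e, h, rfl⟩)
      · exact ⟨i - 1, by omega, by omega⟩
      · exact ⟨e - 1, by omega, by omega⟩
    · rintro ⟨j, hj, rfl⟩
      rcases Nat.mod_two_eq_zero_or_one (j + 1) with h | h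
      · exact Or.inl ⟨j + 1, ⟨by omega, h, by omega⟩, rfl⟩
      · exact Or.inr ⟨j + 1, ⟨by omega, h⟩, rfl⟩
  · simp only [laundryList, cycleList, List.mem_append, List.mem_flatMap, List.mem_filter,
      List.mem_range, Bool.and_eq_true, beq_iff_eq, bne_iff_ne, List.mem_cons,
      mem_bandBlock_inr, false_or, or_false, List.mem_map, Sum.inr.injEq,
      reduceCtorEq, and_false, exists_false, exists_eq_right]
    constructor
    · rintro ⟨e, -, hk, -⟩
      exact hk
    · intro hk
      have hc := hw.colOf_bounds hk
      rcases Nat.mod_two_eq_zero_or_one (colOf w k) with h | h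
      · exact ⟨colOf w k, ⟨by omega, h, by omega⟩, hk, Or.inr rfl⟩
      · exact ⟨colOf w k + 1, ⟨by omega, by omega, by omega⟩, hk, Or.inl rfl⟩

theorem IsBraidWord.length_laundryList {n : ℕ} {w : List Letter} (hw : IsBraidWord n w) :
    (laundryList n w).length = n + w.length := by
  simp [hw.laundryList_perm.length_eq, cycleList]

theorem IsBraidWord.stabilization {n : ℕ} {w : List Letter} (hw : IsBraidWord n w) {ε : ℤ}
    (hε : ε = 1 ∨ ε = -1) : IsBraidWord (n + 1) (w ++ [(n, ε)]) := by
  obtain ⟨hn, -, h⟩ := hw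
  refine ⟨by omega, by simp, fun ℓ hℓ => ?_⟩
  rcases List.mem_append.mp hℓ with hℓ | hℓ
  · have := h ℓ hℓ
    exact ⟨this.1, by omega, this.2.2⟩
  · obtain rfl := List.mem_singleton.mp hℓ
    exact ⟨by dsimp only; omega, by simp, hε⟩

theorem IsBraidWord.laundryList_stabilization_perm {n : ℕ} {w : List Letter}
    (hw : IsBraidWord n w) {ε : ℤ} (hε : ε = 1 ∨ ε = -1) :
    (laundryList (n + 1) (w ++ [(n, ε)])).Perm
      (laundryList n w ++ [Sum.inr w.length, Sum.inl (n + 1)]) := by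
  refine (hw.stabilization hε).laundryList_perm.trans
    (List.Perm.trans ?_ (hw.laundryList_perm.symm.append_right _))
  simp only [cycleList, List.length_append, List.length_singleton, List.range_succ,
    List.map_append, List.map_singleton]
  rw [← Multiset.coe_eq_coe]
  simp only [← Multiset.coe_add, ← Multiset.cons_coe, ← Multiset.singleton_add,
    Multiset.coe_nil]
  abel

/-- Two duplicate-free lists with the same elements differ by a permutation of the indices. -/
theorem exists_perm_getD_eq {α : Type*} [DecidableEq α] {l l' : List α} {N : ℕ}
    (h : l.Perm l') (hl : l.Nodup) (hN : l.length = N) (d : α) :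
    ∃ σ : Equiv.Perm (Fin N), ∀ i : Fin N, l.getD i d = l'.getD (σ i) d := by
  subst hN
  refine ⟨(hl.getEquiv l).trans ((Equiv.subtypeEquivRight fun x => h.mem_iff).trans
    (((h.nodup_iff.mp hl).getEquiv l').symm.trans (finCongr h.length_eq.symm))), fun i => ?_⟩
  have hi : l[(i : ℕ)] ∈ l' := h.mem_iff.mp (List.getElem_mem _)
  have hx : l'.idxOf l[(i : ℕ)] < l'.length := List.idxOf_lt_length_of_mem hi
  have key : l'.getD (l'.idxOf l[(i : ℕ)]) d = l[(i : ℕ)] := by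
    rw [List.getD_eq_getElem _ _ hx, List.getElem_idxOf]
  rw [List.getD_eq_getElem _ _ i.2]
  exact key.symm

/-- The congruence clearing the linking numbers `v` of the added band with the old cycles. -/
def clearing {s : ℕ} (v : Fin s → ℤ) : Matrix (Fin (s + 2)) (Fin (s + 2)) ℤ :=
  Matrix.reindex finSumFinEquiv finSumFinEquiv
    (Matrix.fromBlocks 1 0 (Matrix.of ![0, v]) 1)

theorem det_clearing {s : ℕ} (v : Fin s → ℤ) : (clearing v).det = 1 := by
  simp [clearing]

theorem clearing_congr_tubeAdd {s : ℕ} (A : Matrix (Fin s) (Fin s) ℤ) (b : ℤ) (v : Fin s → ℤ) :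
    (clearing v)ᵀ * tubeAdd A b * clearing v =
      Matrix.reindex finSumFinEquiv finSumFinEquiv
        (Matrix.fromBlocks A (Matrix.of ![v, 0])ᵀ (Matrix.of ![v, 0]) !![b, 1; 1, 0]) := by
  simp only [clearing, tubeAdd, Matrix.reindex_apply, Matrix.transpose_submatrix,
    Matrix.submatrix_mul_equiv, Matrix.fromBlocks_transpose, Matrix.fromBlocks_multiply]
  congr 1
  have h : !![b, 1; 1, 0] * Matrix.of ![0, v] = Matrix.of ![v, 0] := by
    ext i j
    fin_cases i <;> simp [Matrix.mul_apply, Fin.sum_univ_two]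
  have h' : (Matrix.of ![0, v])ᵀ * !![b, 1; 1, 0] = (Matrix.of ![v, 0])ᵀ := by
    ext i j
    fin_cases j <;> simp [Matrix.mul_apply, Fin.sum_univ_two]
  have h'' : (Matrix.of ![v, 0])ᵀ * Matrix.of ![0, v] = 0 := by
    ext i j
    simp [Matrix.mul_apply, Fin.sum_univ_two]
  simp [h, h', h'']

theorem colOf_append_left {w u : List Letter} {k : ℕ} (hk : k < w.length) :
    colOf (w ++ u) k = colOf w k := by
  rw [colOf, colOf, List.getD_append _ _ _ _ hk]

theorem signOf_append_left {w u : List Letter} {k : ℕ} (hk : k < w.length) :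
    signOf (w ++ u) k = signOf w k := by
  rw [signOf, signOf, List.getD_append _ _ _ _ hk]

theorem colOf_concat_length (w : List Letter) (a : Letter) :
    colOf (w ++ [a]) w.length = a.1 := by
  simp [colOf]

theorem signOf_concat_length (w : List Letter) (a : Letter) :
    signOf (w ++ [a]) w.length = a.2 := by
  simp [signOf]

theorem entry_comm (w : List Letter) (x y : Cyc) : entry w x y = entry w y x := by
  rcases x with i | k <;> rcases y with j | l <;> simp only [entry]
  by_cases h : k = l
  · simp [h]
  · rw [if_neg h, if_neg (Ne.symm h)]
    congr 1
    apply propext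
    omega

theorem mem_cycleList_inr {n m k : ℕ} : Sum.inr k ∈ cycleList n m ↔ k < m := by
  simp [cycleList]

theorem entry_append {n : ℕ} {w u : List Letter} {x y : Cyc}
    (hx : x ∈ cycleList n w.length) (hy : y ∈ cycleList n w.length) :
    entry (w ++ u) x y = entry w x y := by
  rcases x with i | k <;> rcases y with j | l
  · rfl
  · simp only [entry, colOf_append_left (mem_cycleList_inr.mp hy)]
  · simp only [entry, colOf_append_left (mem_cycleList_inr.mp hx)]
  · simp only [entry, colOf_append_left (mem_cycleList_inr.mp hx),
      colOf_append_left (mem_cycleList_inr.mp hy), signOf_append_left (mem_cycleList_inr.mp hx)]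

theorem entry_newCircle_old {n : ℕ} {w : List Letter} (hw : IsBraidWord n w) {u : List Letter}
    {x : Cyc} (hx : x ∈ cycleList n w.length) : entry (w ++ u) (Sum.inl (n + 1)) x = 0 := by
  rcases x with i | k
  · rfl
  · rw [mem_cycleList_inr] at hx
    have := hw.colOf_bounds hx
    simp only [entry, colOf_append_left hx]
    rw [if_neg (by omega), if_neg (by omega)]

/-- **Markov stabilization move M2.** The linking matrix of the Markov
stabilization `w ++ [(n, ε)]` (a braid word on `n + 1` strands) is obtained from
`M(w)` by a tube addition `M(w) ↦ M(w) ⊕ [[b, 1], [1, 0]]` up to unimodular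
congruence. -/
theorem linkMat_markov_stabilization_tube_addition (n m : ℕ) (w : List Letter)
    (hw : IsBraidWord n w) (hm : w.length = m) (ε : ℤ) (hε : ε = 1 ∨ ε = -1) :
    ∃ b : ℤ, ∃ P : Matrix (Fin (n + m + 2)) (Fin (n + m + 2)) ℤ,
      (P.det = 1 ∨ P.det = -1) ∧
      linkMat (n + 1) (m + 1) (w ++ [(n, ε)]) =
        Matrix.reindex (finCongr (show n + m + 2 = n + 1 + (m + 1) by omega))
            (finCongr (show n + m + 2 = n + 1 + (m + 1) by omega))
          (Pᵀ * tubeAdd (linkMat n m w) b * P) := by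
  subst hm
  set m := w.length with hm
  set w' := w ++ [(n, ε)] with hw'
  have hperm := hw.laundryList_stabilization_perm hε
  have hlen : (laundryList n w).length = n + m := hw.length_laundryList
  obtain ⟨σ, hσ⟩ := exists_perm_getD_eq (N := n + m + 2) hperm (nodup_laundryList _ _)
    (by rw [hperm.length_eq]; simp [hlen]) (Sum.inl 0)
  set L := laundryList n w ++ [Sum.inr m, Sum.inl (n + 1)] with hL
  let v : Fin (n + m) → ℤ := fun i =>
    entry w' (Sum.inr m) ((laundryList n w).getD i (Sum.inl 0))
  have hold (i : Fin (n + m)) :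
      (laundryList n w).getD i (Sum.inl 0) ∈ cycleList n w.length := by
    rw [← hw.laundryList_perm.mem_iff, List.getD_eq_getElem _ _ (by omega)]
    exact List.getElem_mem _
  have hleft (i : Fin (n + m)) :
      L.getD (Fin.castAdd 2 i) (Sum.inl 0) = (laundryList n w).getD i (Sum.inl 0) :=
    List.getD_append _ _ _ _ (by simp [hlen])
  have hright (i : Fin 2) :
      L.getD (Fin.natAdd (n + m) i) (Sum.inl 0) = ![Sum.inr m, Sum.inl (n + 1)] i := by
    rw [hL, List.getD_append_right _ _ _ _ (by simp [hlen])]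
    fin_cases i <;> simp [hlen]
  have hnew : (clearing v)ᵀ * tubeAdd (linkMat n m w) ε * clearing v =
      Matrix.of fun i j : Fin (n + m + 2) => entry w' (L.getD i (Sum.inl 0)) (L.getD j (Sum.inl 0)) := by
    rw [clearing_congr_tubeAdd]
    ext i j
    have hcm : entry w' (Sum.inl (n + 1)) (Sum.inr m) = 1 := by
      simp [entry, hw', hm, colOf_concat_length]
    refine Fin.addCases (fun i => ?_) (fun i => ?_) i <;>
      refine Fin.addCases (fun j => ?_) (fun j => ?_) j <;>
      simp only [Matrix.of_apply, hleft, hright, Matrix.reindex_apply, Matrix.submatrix_apply,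
        finSumFinEquiv_symm_apply_castAdd, finSumFinEquiv_symm_apply_natAdd,
        Matrix.fromBlocks_apply₁₁, Matrix.fromBlocks_apply₁₂, Matrix.fromBlocks_apply₂₁,
        Matrix.fromBlocks_apply₂₂, Matrix.transpose_apply]
    · exact (entry_append (hold i) (hold j)).symm
    · rw [entry_comm]
      fin_cases j
      · rfl
      · exact (entry_newCircle_old hw (hold i)).symm
    · fin_cases i
      · rfl
      · exact (entry_newCircle_old hw (hold j)).symm
    · fin_cases i <;> fin_cases j
      · simp [entry, hw', hm, signOf_concat_length]
      · exact hcm.symm.trans (entry_comm _ _ _)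
      · exact hcm.symm
      · rfl
  refine ⟨ε, (clearing v).submatrix id σ, ?_, ?_⟩
  · rw [Matrix.det_permute', det_clearing, mul_one]
    rcases Int.units_eq_one_or (Equiv.Perm.sign σ) with h | h <;> simp [h]
  · have : ((clearing v).submatrix id σ)ᵀ * tubeAdd (linkMat n m w) ε *
        (clearing v).submatrix id σ =
        ((clearing v)ᵀ * tubeAdd (linkMat n m w) ε * clearing v).submatrix σ σ := rfl
    rw [this, hnew]
    ext p q
    exact congrArg₂ (entry w') (hσ (Fin.cast (by omega) p)) (hσ (Fin.cast (by omega) q))
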